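/- arXiv:1703.05466 — 2 statements merged into one kernel-verified Lean document; each statement's English description precedes it below -/
import Mathlib

section
/- Let (ℓ_n)_{n≥1} be positive reals with ℓ_n ≥ ℓ_{n+1} for all n, and set u_n = max{log(i+1)/ℓ_{n−i+1} : 1 ≤ i ≤ n}. If ℓ_n/ℓ_{n+1} → 1 as n → ∞, then u_n ℓ_n → ∞ as n → ∞. -/
open Filter

theorem tendsto_div_shift_of_tendsto_div_succ {ℓ : ℕ → ℝ} (hne : ∀ n, 1 ≤ n → ℓ n ≠ 0)
    (hratio : Tendsto (fun n : ℕ => ℓ n / ℓ (n + 1)) atTop (nhds 1)) (k : ℕ) :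
    Tendsto (fun n : ℕ => ℓ n / ℓ (n + k)) atTop (nhds 1) := by
  induction k with
  | zero =>
    refine tendsto_const_nhds.congr' ?_
    filter_upwards [eventually_ge_atTop 1] with n hn
    simp [div_self (hne n hn)]
  | succ k ih =>
    have h := ih.mul (hratio.comp (tendsto_add_atTop_nat k))
    rw [mul_one] at h
    refine h.congr' ?_
    filter_upwards [eventually_ge_atTop 1] with n hn
    exact div_mul_div_cancel₀ (hne (n + k) (by omega))

/-- Lemma `l-unln`(2), first part: for a non-increasing sequence
of positive reals `ℓ` with `ℓ_n/ℓ_{n+1} → 1` and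
`u_n = max{log(i+1)/ℓ_{n-i+1} : 1 ≤ i ≤ n}`, one has `u_n ℓ_n → ∞`. -/
theorem un_mul_ln_tendsto_atTop (ℓ : ℕ → ℝ)
    (hpos : ∀ n, 1 ≤ n → 0 < ℓ n) (hmono : ∀ n, 1 ≤ n → ℓ (n + 1) ≤ ℓ n)
    (hratio : Tendsto (fun n : ℕ => ℓ n / ℓ (n + 1)) atTop (nhds 1)) :
    Tendsto (fun n : ℕ =>
        (sSup ((fun i : ℕ => Real.log ((i : ℝ) + 1) / ℓ (n - i + 1)) '' Set.Icc 1 n)) * ℓ n)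
      atTop atTop := by
  rw [tendsto_atTop]
  intro A
  obtain ⟨k, hk⟩ := ((Real.tendsto_log_atTop.comp
    (tendsto_natCast_atTop_atTop (R := ℝ))).eventually_ge_atTop (2 * A)).exists
  have hlog : 2 * A ≤ Real.log (((k + 1 : ℕ) : ℝ) + 1) := by
    rcases Nat.eq_zero_or_pos k with rfl | hk0
    · have hA : 2 * A ≤ 0 := by simpa using hk
      exact hA.trans (Real.log_nonneg (by simp))
    · refine hk.trans (Real.log_le_log (by exact_mod_cast hk0) ?_)
      push_cast
      linarith
  have hev := (tendsto_div_shift_of_tendsto_div_succ (fun n hn => (hpos n hn).ne')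
    hratio k).eventually_lt_const one_lt_two
  filter_upwards [(tendsto_sub_atTop_nat k).eventually hev, eventually_ge_atTop (k + 1)]
    with n hn hkn
  have hn_pos := hpos n (by omega)
  have hm_pos := hpos (n - k) (by omega)
  rw [Nat.sub_add_cancel (by omega), div_lt_iff₀ hn_pos] at hn
  have hle : Real.log (((k + 1 : ℕ) : ℝ) + 1) / ℓ (n - k) ≤
      sSup ((fun i : ℕ => Real.log ((i : ℝ) + 1) / ℓ (n - i + 1)) '' Set.Icc 1 n) := by
    refine le_csSup ((Set.finite_Icc 1 n).image _).bddAbove ⟨k + 1, ⟨by omega, hkn⟩, ?_⟩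
    simp only [show n - (k + 1) + 1 = n - k by omega]
  refine le_trans ?_ (mul_le_mul_of_nonneg_right hle hn_pos.le)
  have hlog0 : 0 ≤ Real.log (((k + 1 : ℕ) : ℝ) + 1) :=
    Real.log_nonneg (by simp only [le_add_iff_nonneg_left]; positivity)
  rw [div_mul_eq_mul_div, le_div_iff₀ hm_pos]
  nlinarith
end

section
/- Let (ℓ_n)_{n≥1} be positive reals with ℓ_n ≥ ℓ_{n+1} for all n, and set u_n = max{log(i+1)/ℓ_{n−i+1} : 1 ≤ i ≤ n}. If liminf_{n→∞} ℓ_n/ℓ_{n+1} > 1, then the sequence (u_n ℓ_n)_{n≥1} is bounded. -/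
open Filter

/-- If the liminf of a real sequence exceeds `a`, then some `r > a` is an eventual lower bound. -/
lemma exists_lt_eventually_le_of_lt_liminf {f : ℕ → ℝ} {a : ℝ} (ha : 0 ≤ a)
    (h : a < atTop.liminf f) : ∃ r, a < r ∧ ∀ᶠ n in atTop, r ≤ f n := by
  rw [liminf_eq] at h
  have hne : {b | ∀ᶠ n in atTop, b ≤ f n}.Nonempty := by
    by_contra hempty
    rw [Set.not_nonempty_iff_eq_empty.mp hempty, Real.sSup_empty] at h
    linarith
  obtain ⟨r, hr, har⟩ := exists_lt_of_lt_csSup hne h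
  exact ⟨r, har, hr⟩

/-- A non-increasing positive sequence which eventually contracts by the factor `q` decays
geometrically, uniformly in the starting index. -/
lemma mul_pow_le_pow_mul_of_eventually_contracting {ℓ : ℕ → ℝ} {q : ℝ} {N : ℕ}
    (hq0 : 0 ≤ q) (hq1 : q ≤ 1)
    (hpos : ∀ n, 1 ≤ n → 0 < ℓ n) (hmono : ∀ n, 1 ≤ n → ℓ (n + 1) ≤ ℓ n)
    (hstep : ∀ n, N ≤ n → 1 ≤ n → ℓ (n + 1) ≤ q * ℓ n) {m : ℕ} (hm : 1 ≤ m) (k : ℕ) :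
    ℓ (m + k) * q ^ N ≤ q ^ k * ℓ m := by
  have hanti : ∀ k, ℓ (m + k) ≤ ℓ m := fun k => by
    induction k with
    | zero => simp
    | succ k ih => exact (hmono (m + k) (by omega)).trans ih
  induction k with
  | zero => simpa using mul_le_of_le_one_right (hpos m hm).le (pow_le_one₀ hq0 hq1)
  | succ k ih =>
    rcases le_or_gt (k + 1) N with hk | hk
    · rw [mul_comm]
      exact mul_le_mul (pow_le_pow_of_le_one hq0 hq1 hk) (hanti _)
        (hpos _ (by omega)).le (pow_nonneg hq0 _)
    · calc ℓ (m + (k + 1)) * q ^ N ≤ (q * ℓ (m + k)) * q ^ N :=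
            mul_le_mul_of_nonneg_right (hstep (m + k) (by omega) (by omega)) (pow_nonneg hq0 _)
        _ = q * (ℓ (m + k) * q ^ N) := by ring
        _ ≤ q * (q ^ k * ℓ m) := mul_le_mul_of_nonneg_left ih hq0
        _ = q ^ (k + 1) * ℓ m := by ring

/-- Lemma `l-unln`(2), second part: for a non-increasing sequence
of positive reals `ℓ` with `liminf ℓ_n/ℓ_{n+1} > 1` and
`u_n = max{log(i+1)/ℓ_{n-i+1} : 1 ≤ i ≤ n}`, the sequence `u_n ℓ_n` is bounded. -/
theorem un_mul_ln_bounded (ℓ : ℕ → ℝ)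
    (hpos : ∀ n, 1 ≤ n → 0 < ℓ n) (hmono : ∀ n, 1 ≤ n → ℓ (n + 1) ≤ ℓ n)
    (hliminf : 1 < atTop.liminf (fun n : ℕ => ℓ n / ℓ (n + 1))) :
    ∃ M : ℝ, ∀ n : ℕ, 1 ≤ n →
      (sSup ((fun i : ℕ => Real.log ((i : ℝ) + 1) / ℓ (n - i + 1)) '' Set.Icc 1 n)) * ℓ n
        ≤ M := by
  obtain ⟨r, hr, hev⟩ := exists_lt_eventually_le_of_lt_liminf zero_le_one hliminf
  obtain ⟨N, hN⟩ := eventually_atTop.mp hev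
  have hr0 : 0 < r := by linarith
  have hq0 : 0 < r⁻¹ := inv_pos.mpr hr0
  have hq1 : r⁻¹ < 1 := inv_lt_one_of_one_lt₀ hr
  have hstep : ∀ n, N ≤ n → 1 ≤ n → ℓ (n + 1) ≤ r⁻¹ * ℓ n := fun n hn _ => by
    rw [le_inv_mul_iff₀ hr0]
    exact (le_div_iff₀ (hpos (n + 1) (by omega))).mp (hN n hn)
  obtain ⟨B, hB⟩ := (tendsto_self_mul_const_pow_of_lt_one hq0.le hq1).bddAbove_range
  generalize r⁻¹ = q at *
  refine ⟨B / q ^ (N + 1), fun n hn => ?_⟩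
  rw [← le_div_iff₀ (hpos n hn)]
  refine csSup_le ((Set.nonempty_Icc.mpr hn).image _) ?_
  rintro _ ⟨i, ⟨hi1, hin⟩, rfl⟩
  have hm := hpos (n - i + 1) (by omega)
  have hdecay := mul_pow_le_pow_mul_of_eventually_contracting hq0.le hq1.le hpos hmono hstep
    (m := n - i + 1) (by omega) (i - 1)
  rw [show n - i + 1 + (i - 1) = n by omega] at hdecay
  have hlog : Real.log ((i : ℝ) + 1) ≤ i := by
    have := Real.log_le_sub_one_of_pos (show (0 : ℝ) < (i : ℝ) + 1 by positivity)
    linarith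
  have hBi : (i : ℝ) * q ^ i ≤ B := hB ⟨i, rfl⟩
  have hqi : q ^ (i - 1) * q = q ^ i := by rw [← pow_succ, Nat.sub_add_cancel hi1]
  change Real.log ((i : ℝ) + 1) / ℓ (n - i + 1) ≤ _
  rw [div_le_div_iff₀ hm (hpos n hn), div_mul_eq_mul_div, le_div_iff₀ (by positivity)]
  calc Real.log ((i : ℝ) + 1) * ℓ n * q ^ (N + 1)
      ≤ i * ℓ n * q ^ (N + 1) := by
        have := hpos n hn
        gcongr
    _ = i * q * (ℓ n * q ^ N) := by ring
    _ ≤ i * q * (q ^ (i - 1) * ℓ (n - i + 1)) := by gcongr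
    _ = i * q ^ i * ℓ (n - i + 1) := by rw [← hqi]; ring
    _ ≤ B * ℓ (n - i + 1) := by gcongr
end
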